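/- Let ρ_C, α > 0, I_0 ≥ 0 and τ_C, τ_B, τ_I > 0 with I_0 < 1/(τ_C ρ_C). All three components of the equilibrium P_2 = ((1/α)(I_0/(τ_I(1/(τ_C ρ_C) − I_0)) − 1/τ_B), 0, 1/(τ_C ρ_C) − I_0) are non-negative if and only if (1/(τ_C ρ_C))(1 − τ_B/(τ_B + τ_I)) ≤ I_0 < 1/(τ_C ρ_C). -/

import Mathlib

/-- **Biological meaningfulness of `P₂`.**
With `I₀ < 1/(τCρC)`, all three components of the equilibrium
`P₂ = ((1/α)(I₀/(τI(1/(τCρC) − I₀)) − 1/τB), 0, 1/(τCρC) − I₀)`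
are non-negative if and only if
`(1/(τCρC))(1 − τB/(τB + τI)) ≤ I₀ < 1/(τCρC)`. -/
theorem P2_nonneg_iff
    (ρC α I₀ τC τB τI : ℝ)
    (hρC : 0 < ρC) (hα : 0 < α) (hI₀ : 0 ≤ I₀)
    (hτC : 0 < τC) (hτB : 0 < τB) (hτI : 0 < τI)
    (hlt : I₀ < 1 / (τC * ρC)) :
    (0 ≤ (1 / α) * (I₀ / (τI * (1 / (τC * ρC) - I₀)) - 1 / τB) ∧
        (0 : ℝ) ≤ 0 ∧
        0 ≤ 1 / (τC * ρC) - I₀) ↔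
      ((1 / (τC * ρC)) * (1 - τB / (τB + τI)) ≤ I₀ ∧ I₀ < 1 / (τC * ρC)) := by
  generalize 1 / (τC * ρC) = K at *
  have hd : 0 < K - I₀ := sub_pos.mpr hlt
  have hs : 0 < τB + τI := by positivity
  have e : K * (1 - τB / (τB + τI)) = K * τI / (τB + τI) := by
    field_simp
    ring
  rw [e, div_le_iff₀ hs, mul_nonneg_iff_of_pos_left (by positivity), sub_nonneg,
    div_le_div_iff₀ hτB (by positivity)]
  constructor
  · rintro ⟨h, -, -⟩
    exact ⟨by linarith, hlt⟩
  · rintro ⟨h, -⟩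
    exact ⟨by linarith, le_refl _, hd.le⟩
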